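/- Let L > 0, n ≥ 1, λₙ = n²π²/L². Define Λₙ = {a ∈ L¹(0,L) : λₙ ≺ a and u'' + au = 0, u'(0) = u'(L) = 0 has a nontrivial solution}, and β₁,ₙ = inf_{a ∈ Λₙ} ‖a - λₙ‖_{L¹(0,L)}. Then β₁,ₙ = (2πn(n+1)/L) · cot(nπ/(2(n+1))). -/

import Mathlib

open MeasureTheory Real Set intervalIntegral

/-- product rule for primitives -/
lemma prod_prim {c d : ℝ} (hcd : c ≤ d) {F G f g : ℝ → ℝ}
    (hf : IntervalIntegrable f volume c d) (hg : IntervalIntegrable g volume c d)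
    (hF : ∀ x ∈ Icc c d, F x = F c + ∫ t in c..x, f t)
    (hG : ∀ x ∈ Icc c d, G x = G c + ∫ t in c..x, g t) :
    ∫ x in c..d, (f x * G x + F x * g x) = F d * G d - F c * G c := by
  set F1 : ℝ → ℝ := fun x => F c + ∫ t in c..x, f t with hF1
  set G1 : ℝ → ℝ := fun x => G c + ∫ t in c..x, g t with hG1
  have acc : ∀ k : ℝ, AbsolutelyContinuousOnInterval (fun _ : ℝ => k) c d := fun k =>
    (contDiff_const.contDiffOn (n := 1)).absolutelyContinuousOnInterval
  have acF : AbsolutelyContinuousOnInterval F1 c d :=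
    (acc (F c)).add (hf.absolutelyContinuousOnInterval_intervalIntegral (c := c) (by simp))
  have acG : AbsolutelyContinuousOnInterval G1 c d :=
    (acc (G c)).add (hg.absolutelyContinuousOnInterval_intervalIntegral (c := c) (by simp))
  have key := acF.integral_deriv_mul_eq_sub acG
  have e1 : F1 d = F d := (hF d ⟨hcd, le_rfl⟩).symm
  have e2 : G1 d = G d := (hG d ⟨hcd, le_rfl⟩).symm
  have e3 : F1 c = F c := by simp [hF1]
  have e4 : G1 c = G c := by simp [hG1]
  rw [e1, e2, e3, e4] at key
  rw [← key]
  apply intervalIntegral.integral_congr_ae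
  filter_upwards [hf.ae_hasDerivAt_integral, hg.ae_hasDerivAt_integral] with x h1 h2 hx
  have hx' : x ∈ uIcc c d := uIoc_subset_uIcc hx
  have d1 : deriv F1 x = f x := ((h1 hx' c (by simp)).const_add (F c)).deriv
  have d2 : deriv G1 x = g x := ((h2 hx' c (by simp)).const_add (G c)).deriv
  rw [uIcc_of_le hcd] at hx'
  rw [d1, d2, hF x hx', hG x hx']

/-- regular solutions of `u' = v`, `v' = -a u` on `[0,L]` with `a ≥ s²` -/
structure Sol (L s : ℝ) (a u v : ℝ → ℝ) : Prop where
  hs : 0 < s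
  ha : IntervalIntegrable a volume 0 L
  hu : ContinuousOn u (Icc 0 L)
  hv : ContinuousOn v (Icc 0 L)
  h1 : ∀ x ∈ Icc 0 L, ∀ y ∈ Icc 0 L, u y = u x + ∫ t in x..y, v t
  h2 : ∀ x ∈ Icc 0 L, ∀ y ∈ Icc 0 L, v y = v x + ∫ t in x..y, -(a t * u t)
  hab : ∀ᵐ x, x ∈ Ioo 0 L → s ^ 2 ≤ a x

namespace Sol
variable {L s : ℝ} {a u v : ℝ → ℝ}

lemma neg (H : Sol L s a u v) : Sol L s a (fun x => - u x) (fun x => - v x) where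
  hs := H.hs
  ha := H.ha
  hu := H.hu.neg
  hv := H.hv.neg
  h1 x hx y hy := by rw [H.h1 x hx y hy]; simp; ring
  h2 x hx y hy := by rw [H.h2 x hx y hy]; simp; ring
  hab := H.hab

lemma reflect (H : Sol L s a u v) :
    Sol L s (fun x => a (L - x)) (fun x => - u (L - x)) (fun x => v (L - x)) where
  hs := H.hs
  ha := by
    have := H.ha.comp_sub_left L
    simp at this
    exact this.symm
  hu := by
    apply ContinuousOn.neg
    apply H.hu.comp (by fun_prop)
    intro x hx; simp at hx ⊢; constructor <;> linarith
  hv := by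
    apply H.hv.comp (by fun_prop)
    intro x hx; simp at hx ⊢; constructor <;> linarith
  h1 x hx y hy := by
    have := H.h1 (L - y) (by simp at hy ⊢; constructor <;> linarith) (L-x)
      (by simp at hx ⊢; constructor <;> linarith)
    rw [intervalIntegral.integral_comp_sub_left (fun t => v t), this]; ring
  h2 x hx y hy := by
    have := H.h2 (L - y) (by simp at hy ⊢; constructor <;> linarith) (L-x)
      (by simp at hx ⊢; constructor <;> linarith)
    have h := intervalIntegral.integral_comp_sub_left (fun t => -(a t * - u t)) L (a := x) (b := y)
    rw [h, this]; simp
  hab := by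
    have := H.hab
    have h2 : Measure.QuasiMeasurePreserving (fun x : ℝ => L - x) volume volume :=
      (Measure.measurePreserving_sub_left volume L).quasiMeasurePreserving
    filter_upwards [h2.ae this] with x hx hx2
    apply hx
    simp at hx2 ⊢; constructor <;> linarith

lemma sub_ii (H : Sol L s a u v) {c d : ℝ} (hc : 0 ≤ c) (hcd : c ≤ d) (hd : d ≤ L) :
    IntervalIntegrable a volume c d := by
  apply H.ha.mono_set
  rw [uIcc_of_le hcd, uIcc_of_le (by linarith)]
  exact Icc_subset_Icc hc hd

lemma au_ii (H : Sol L s a u v) {c d : ℝ} (hc : 0 ≤ c) (hcd : c ≤ d) (hd : d ≤ L)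
    {f : ℝ → ℝ} (hf : ContinuousOn f (Icc c d)) :
    IntervalIntegrable (fun x => a x * f x) volume c d := by
  apply (H.sub_ii hc hcd hd).mul_continuousOn
  rwa [uIcc_of_le hcd]

lemma hu' (H : Sol L s a u v) {c d : ℝ} (hc : 0 ≤ c) (hd : d ≤ L) : ContinuousOn u (Icc c d) :=
  H.hu.mono (Icc_subset_Icc hc hd)
lemma hv' (H : Sol L s a u v) {c d : ℝ} (hc : 0 ≤ c) (hd : d ≤ L) : ContinuousOn v (Icc c d) :=
  H.hv.mono (Icc_subset_Icc hc hd)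

lemma wronskian (H : Sol L s a u v) {c d : ℝ} (hc : 0 ≤ c) (hcd : c ≤ d) (hd : d ≤ L)
    {p p' : ℝ → ℝ} (hp : ∀ x, HasDerivAt p (p' x) x) (hp' : ∀ x, HasDerivAt p' (-(s^2) * p x) x) :
    ∫ x in c..d, (a x - s^2) * (u x * p x) =
      (v c * p c - u c * p' c) - (v d * p d - u d * p' d) := by
  have cp : Continuous p := continuous_iff_continuousAt.2 fun x => (hp x).continuousAt
  have cp' : Continuous p' := continuous_iff_continuousAt.2 fun x => (hp' x).continuousAt
  have cL : c ∈ Icc 0 L := ⟨hc, by linarith⟩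
  have sub : Icc c d ⊆ Icc 0 L := Icc_subset_Icc hc hd
  have hu := H.hu' hc hd
  have hv := H.hv' hc hd
  have i1 : IntervalIntegrable (fun t => -(a t * u t)) volume c d := (H.au_ii hc hcd hd hu).neg
  have i2 : IntervalIntegrable v volume c d := by
    apply ContinuousOn.intervalIntegrable; rwa [uIcc_of_le hcd]
  have q1 := prod_prim hcd (F := v) (G := p) i1 (cp'.intervalIntegrable c d)
    (fun x hx => H.h2 c cL x (sub hx))
    (fun x hx => by
      rw [integral_eq_sub_of_hasDerivAt (fun x _ => hp x) (cp'.intervalIntegrable c x)]; ring)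
  have q2 := prod_prim hcd (F := u) (G := p') (g := fun x => -(s^2) * p x) i2
    ((cp.const_mul _).intervalIntegrable c d)
    (fun x hx => H.h1 c cL x (sub hx))
    (fun x hx => by
      rw [integral_eq_sub_of_hasDerivAt (fun x _ => hp' x)
        ((cp.const_mul _).intervalIntegrable c x)]; ring)
  have j1 : IntervalIntegrable (fun x => -(a x * u x) * p x + v x * p' x) volume c d := by
    apply IntervalIntegrable.add
    · exact i1.mul_continuousOn cp.continuousOn
    · exact i2.mul_continuousOn cp'.continuousOn
  have j2 : IntervalIntegrable (fun x => v x * p' x + u x * (-(s^2) * p x)) volume c d := by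
    apply ContinuousOn.intervalIntegrable
    rw [uIcc_of_le hcd]
    exact (hv.mul cp'.continuousOn).add (hu.mul (cp.const_mul _).continuousOn)
  have := intervalIntegral.integral_sub j2 j1
  rw [q1, q2] at this
  rw [show (∫ x in c..d, (a x - s^2) * (u x * p x)) = ∫ x in c..d,
    (v x * p' x + u x * (-(s^2) * p x)) - (-(a x * u x) * p x + v x * p' x) from
    intervalIntegral.integral_congr (fun x _ => by ring), this]
  ring

/-- `∫ (a-s²) f ≥ 0` for `f ≥ 0`. -/
lemma b_ae (H : Sol L s a u v) {c d : ℝ} (hc : 0 ≤ c) (hd : d ≤ L) :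
    ∀ᵐ x ∂(volume.restrict (Ioc c d)), s ^ 2 ≤ a x := by
  rw [ae_restrict_iff' measurableSet_Ioc]
  have : ∀ᵐ x : ℝ, x ≠ L := by simp [ae_iff, measure_singleton]
  filter_upwards [H.hab, this] with x hx hx2 hx3
  exact hx ⟨by linarith [hx3.1], lt_of_le_of_ne (hx3.2.trans hd) hx2⟩

lemma b_ii (H : Sol L s a u v) {c d : ℝ} (hc : 0 ≤ c) (hcd : c ≤ d) (hd : d ≤ L) :
    IntervalIntegrable (fun x => a x - s^2) volume c d :=
  (H.sub_ii hc hcd hd).sub intervalIntegrable_const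

lemma int_mono (H : Sol L s a u v) {c d : ℝ} (hc : 0 ≤ c) (hcd : c ≤ d) (hd : d ≤ L)
    {f g : ℝ → ℝ} (hf : ContinuousOn f (Icc c d)) (hg : ContinuousOn g (Icc c d))
    (h : ∀ x ∈ Icc c d, f x ≤ g x) :
    ∫ x in c..d, (a x - s^2) * f x ≤ ∫ x in c..d, (a x - s^2) * g x := by
  have hb := H.b_ii hc hcd hd
  apply intervalIntegral.integral_mono_ae_restrict hcd
  · apply hb.mul_continuousOn; rwa [uIcc_of_le hcd]
  · apply hb.mul_continuousOn; rwa [uIcc_of_le hcd]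
  · have := H.b_ae hc hd
    rw [← restrict_Ioc_eq_restrict_Icc]
    filter_upwards [this, ae_restrict_mem measurableSet_Ioc] with x hx hx2
    exact mul_le_mul_of_nonneg_left (h x ⟨hx2.1.le, hx2.2⟩) (by linarith)

lemma int_nonneg (H : Sol L s a u v) {c d : ℝ} (hc : 0 ≤ c) (hcd : c ≤ d) (hd : d ≤ L)
    {g : ℝ → ℝ} (hg : ContinuousOn g (Icc c d))
    (h : ∀ x ∈ Icc c d, 0 ≤ g x) :
    0 ≤ ∫ x in c..d, (a x - s^2) * g x := by
  have := H.int_mono hc hcd hd (f := fun _ => 0) continuousOn_const hg h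
  simpa using this

lemma int_b_nonneg (H : Sol L s a u v) {c d : ℝ} (hc : 0 ≤ c) (hcd : c ≤ d) (hd : d ≤ L) :
    0 ≤ ∫ x in c..d, (a x - s^2) := by
  have := H.int_nonneg hc hcd hd (g := fun _ => 1) continuousOn_const (by simp)
  simpa using this

/-- if `u>0` on `(c,d)` then `v` strictly decreases -/
lemma v_lt (H : Sol L s a u v) {c d : ℝ} (hc : 0 ≤ c) (hcd : c < d) (hd : d ≤ L)
    (hpos : ∀ x ∈ Ioo c d, 0 < u x) : v d < v c := by
  rw [H.h2 c ⟨hc, by linarith⟩ d ⟨by linarith, hd⟩]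
  have hu := H.hu' hc hd
  have pos : ∀ x ∈ Icc c d, 0 ≤ u x := by
    have : Icc c d = closure (Ioo c d) := (closure_Ioo hcd.ne).symm
    rw [this] at hu ⊢
    exact fun x hx => le_on_closure (f := fun _ => 0) (fun y hy => (hpos y hy).le)
      continuousOn_const hu hx
  have k1 := H.int_nonneg hc hcd.le hd (H.hu' hc hd) pos
  have k2 : 0 < ∫ x in c..d, s^2 * u x := by
    apply intervalIntegral.intervalIntegral_pos_of_pos_on _ _ hcd
    · apply ContinuousOn.intervalIntegrable; rw [uIcc_of_le hcd.le]
      exact continuousOn_const.mul (H.hu' hc hd)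
    · intro x hx; have := hpos x hx; have := H.hs; positivity
  have k3 : IntervalIntegrable (fun x => (a x - s^2) * u x) volume c d := by
    apply (H.b_ii hc hcd.le hd).mul_continuousOn; rw [uIcc_of_le hcd.le]; exact H.hu' hc hd
  have k4 : IntervalIntegrable (fun x => s^2 * u x) volume c d := by
    apply ContinuousOn.intervalIntegrable; rw [uIcc_of_le hcd.le]
    exact continuousOn_const.mul (H.hu' hc hd)
  have k5 := intervalIntegral.integral_add k3 k4
  have : (∫ x in c..d, -(a x * u x)) = - ∫ x in c..d, (a x - s^2) * u x + s^2 * u x := by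
    rw [← intervalIntegral.integral_neg]
    exact intervalIntegral.integral_congr (fun x _ => by ring)
  rw [this, k5]; linarith

end Sol

namespace Sol
variable {L s : ℝ} {a u v : ℝ → ℝ}

lemma hasDeriv_sin_aux (s d x : ℝ) :
    HasDerivAt (fun x => sin (s * (d - x))) (-(s * cos (s * (d - x)))) x := by
  have h : HasDerivAt (fun x : ℝ => s * (d - x)) (-s) x := by
    simpa using ((hasDerivAt_id x).const_sub d).const_mul s
  convert! h.sin using 1; ring

lemma hasDeriv_sin_aux' (s d x : ℝ) :
    HasDerivAt (fun x => -(s * cos (s * (d - x)))) (-(s ^ 2) * sin (s * (d - x))) x := by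
  have h : HasDerivAt (fun x : ℝ => s * (d - x)) (-s) x := by
    simpa using ((hasDerivAt_id x).const_sub d).const_mul s
  convert! (h.cos.const_mul s).neg using 1; ring

/-- quarter wave: `v c = 0`, `u > 0` on `[c,d)`, `u d = 0`. -/
lemma piece (H : Sol L s a u v) {c d : ℝ} (hc : 0 ≤ c) (hcd : c < d) (hd : d ≤ L)
    (hpos : ∀ x ∈ Ico c d, 0 < u x) (hvc : v c = 0) (hud : u d = 0) :
    s * (d - c) ≤ π / 2 ∧ (s * (d - c) = π / 2 → ∫ x in c..d, (a x - s^2) = 0) ∧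
    s * cot (s * (d - c)) ≤ ∫ x in c..d, (a x - s^2) := by
  have hs := H.hs
  have hu := H.hu' hc hd
  have upos : ∀ x ∈ Icc c d, 0 ≤ u x := by
    intro x hx
    rcases hx.2.lt_or_eq with h | h
    · exact (hpos x ⟨hx.1, h⟩).le
    · rw [h, hud]
  have vneg : ∀ x ∈ Icc c d, v x ≤ 0 := by
    intro x hx
    rcases hx.1.lt_or_eq with h | h
    · rw [← hvc]
      exact (H.v_lt hc h (hx.2.trans hd) (fun y hy => hpos y ⟨hy.1.le, hy.2.trans_le hx.2⟩)).le
    · rw [← h, hvc]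
  have ule : ∀ x ∈ Icc c d, u x ≤ u c := by
    intro x hx
    rw [H.h1 c ⟨hc, by linarith⟩ x ⟨by linarith [hx.1], by linarith [hx.2]⟩]
    have : 0 ≤ ∫ t in c..x, - v t := by
      apply intervalIntegral.integral_nonneg hx.1
      intro y hy; linarith [vneg y ⟨hy.1, hy.2.trans hx.2⟩]
    rw [intervalIntegral.integral_neg] at this
    linarith
  have uc := hpos c ⟨le_rfl, hcd⟩
  have len : s * (d - c) ≤ π / 2 := by
    by_contra hcon
    push Not at hcon
    set c' := c + π / 2 / s with hc'
    have e1 : s * (c' - c) = π / 2 := by rw [hc']; field_simp; ring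
    have e2 : c < c' := by rw [hc']; have := pi_pos; linarith [div_pos (div_pos this two_pos) hs]
    have e3 : c' < d := by
      have : s * (c' - c) < s * (d - c) := by rw [e1]; exact hcon
      linarith [lt_of_mul_lt_mul_left this hs.le]
    have W := H.wronskian hc e2.le (by linarith : c' ≤ L) (hasDeriv_sin_aux s c')
      (hasDeriv_sin_aux' s c')
    have nn := H.int_nonneg hc e2.le (by linarith : c' ≤ L)
      (g := fun x => u x * sin (s * (c' - x)))
      ((hu.mono (Icc_subset_Icc le_rfl e3.le)).mul (by fun_prop))
      (fun x hx => mul_nonneg (upos x ⟨hx.1, hx.2.trans e3.le⟩) (by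
        apply sin_nonneg_of_nonneg_of_le_pi
        · exact mul_nonneg hs.le (by linarith [hx.2])
        · have : s * (c' - x) ≤ s * (c' - c) := mul_le_mul_of_nonneg_left (by linarith [hx.1]) hs.le
          linarith [pi_pos]))
    rw [W] at nn
    simp only [e1, sub_self, mul_zero, sin_zero, cos_zero, hvc, sin_pi_div_two, cos_pi_div_two] at nn
    have := mul_pos (hpos c' ⟨e2.le, e3⟩) hs
    nlinarith
  have W := H.wronskian hc hcd.le hd (hasDeriv_sin_aux s d) (hasDeriv_sin_aux' s d)
  simp only [sub_self, mul_zero, hvc, hud, sin_zero, zero_mul] at W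
  have hlt : 0 < s * (d - c) := mul_pos hs (by linarith)
  have hsin : 0 < sin (s * (d - c)) := sin_pos_of_pos_of_lt_pi hlt (by linarith [pi_pos])
  have hsl : ∀ x ∈ Icc c d, s * (d - x) ≤ s * (d - c) := fun x hx =>
    mul_le_mul_of_nonneg_left (by linarith [hx.1]) hs.le
  have hs0 : ∀ x ∈ Icc c d, 0 ≤ s * (d - x) := fun x hx =>
    mul_nonneg hs.le (by linarith [hx.2])
  refine ⟨len, ?_, ?_⟩
  · intro heq
    rw [heq, cos_pi_div_two] at W
    have W0 : ∫ x in c..d, (a x - s^2) * (u x * sin (s * (d - x))) = 0 := by rw [W]; ring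
    rw [intervalIntegral.integral_eq_zero_iff_of_nonneg_ae] at W0
    · rw [Ioc_eq_empty (by linarith : ¬ d < c), union_empty] at W0
      apply intervalIntegral.integral_zero_ae
      rw [uIoc_of_le hcd.le]
      rw [Filter.EventuallyEq, ae_restrict_iff' measurableSet_Ioc] at W0
      have : ∀ᵐ x : ℝ, x ≠ d := by simp [ae_iff, measure_singleton]
      filter_upwards [W0, this] with x hx hx2 hx3
      have h := hx hx3
      have hxd : x < d := lt_of_le_of_ne hx3.2 hx2
      have p1 := hpos x ⟨hx3.1.le, hxd⟩
      have p2 : 0 < sin (s * (d - x)) := by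
        apply sin_pos_of_pos_of_lt_pi
        · exact mul_pos hs (by linarith)
        · linarith [hsl x ⟨hx3.1.le, hx3.2⟩, pi_pos]
      have p3 := (mul_pos p1 p2).ne'
      simpa [p3, p1.ne', p2.ne'] using h
    · rw [Ioc_eq_empty (by linarith : ¬ d < c), union_empty]
      filter_upwards [H.b_ae hc hd, ae_restrict_mem measurableSet_Ioc] with x hx hx2
      have hx3 : x ∈ Icc c d := ⟨hx2.1.le, hx2.2⟩
      apply mul_nonneg (by linarith)
      apply mul_nonneg (upos x hx3)
      exact sin_nonneg_of_nonneg_of_le_pi (hs0 x hx3) (by linarith [hsl x hx3, pi_pos])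
    · apply (H.b_ii hc hcd.le hd).mul_continuousOn
      rw [uIcc_of_le hcd.le]
      exact hu.mul (by fun_prop)
  · have M := H.int_mono hc hcd.le hd (f := fun x => u x * sin (s * (d - x)))
      (g := fun _ => u c * sin (s * (d - c))) (hu.mul (by fun_prop)) continuousOn_const
      (fun x hx => by
        apply mul_le_mul (ule x hx) _ _ uc.le
        · apply sin_le_sin_of_le_of_le_pi_div_two _ len (hsl x hx)
          linarith [hs0 x hx, pi_pos]
        · exact sin_nonneg_of_nonneg_of_le_pi (hs0 x hx) (by linarith [hsl x hx, pi_pos]))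
    rw [W, intervalIntegral.integral_mul_const] at M
    rw [cot_eq_cos_div_sin, ← mul_div_assoc, div_le_iff₀ hsin]
    have : u c * (s * cos (s * (d - c))) ≤
        u c * ((∫ x in c..d, (a x - s^2)) * sin (s * (d - c))) := by linarith
    exact le_of_mul_le_mul_left this uc

lemma first_zero {f : ℝ → ℝ} {c L : ℝ} (hf : ContinuousOn f (Icc c L)) (h0 : 0 < f c)
    (hz : ∃ z ∈ Icc c L, f z ≤ 0) :
    ∃ d, c < d ∧ d ≤ L ∧ f d = 0 ∧ ∀ x ∈ Ico c d, 0 < f x := by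
  have hcl : IsCompact (Icc c L ∩ f ⁻¹' Iic 0) :=
    isCompact_Icc.of_isClosed_subset (hf.preimage_isClosed_of_isClosed isClosed_Icc isClosed_Iic)
      inter_subset_left
  obtain ⟨z, hz, hz0⟩ := hz
  obtain ⟨d, ⟨hd, hfd⟩, hmin⟩ := hcl.exists_isLeast ⟨z, hz, hz0⟩
  have hfd : f d ≤ 0 := hfd
  have hcd : c < d := lt_of_le_of_ne hd.1 (fun h => by rw [← h] at hfd; linarith)
  have hp : ∀ x ∈ Ico c d, 0 < f x := by
    intro x hx
    by_contra hcon
    have := hmin ⟨⟨hx.1, hx.2.le.trans hd.2⟩, not_lt.1 hcon⟩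
    linarith [hx.2]
  refine ⟨d, hcd, hd.2, ?_, hp⟩
  obtain ⟨y, hy, hy0⟩ := intermediate_value_Icc' hd.1 (hf.mono (Icc_subset_Icc le_rfl hd.2))
    (show (0:ℝ) ∈ Icc (f d) (f c) from ⟨hfd, h0.le⟩)
  rcases hy.2.lt_or_eq with h | h
  · have := hp y ⟨hy.1, h⟩; linarith
  · rw [← h]; exact hy0

lemma cot_tangent {y y0 : ℝ} (hy : 0 < y) (hy2 : y ≤ π / 2) (h0 : 0 < y0) (h02 : y0 ≤ π / 2) :
    cot y0 - (y - y0) / sin y0 ^ 2 ≤ cot y := by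
  have hder : ∀ x, 0 < x → x ≤ π / 2 → HasDerivAt cot (-(1 / sin x ^ 2)) x := by
    intro x hx hx2
    have hsn : sin x ≠ 0 := (sin_pos_of_pos_of_lt_pi hx (by linarith [pi_pos])).ne'
    have := (hasDerivAt_cos x).div (hasDerivAt_sin x) hsn
    have e : cot = fun x => cos x / sin x := by funext x; exact cot_eq_cos_div_sin x
    rw [e]
    convert! this using 1
    field_simp
    linarith [sin_sq_add_cos_sq x]
  have hs0 : 0 < sin y0 := sin_pos_of_pos_of_lt_pi h0 (by linarith [pi_pos])
  rcases lt_trichotomy y y0 with h | h | h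
  · obtain ⟨ξ, hξ, hξ2⟩ := exists_hasDerivAt_eq_slope cot (fun x => -(1 / sin x ^ 2)) h
      (fun x hx => (hder x (hy.trans_le hx.1) (hx.2.trans h02)).continuousAt.continuousWithinAt)
      (fun x hx => hder x (hy.trans hx.1) (hx.2.le.trans h02))
    have hsξ : 0 < sin ξ := sin_pos_of_pos_of_lt_pi (hy.trans hξ.1) (by linarith [pi_pos, hξ.2])
    have : sin ξ ≤ sin y0 := sin_le_sin_of_le_of_le_pi_div_two (by linarith [hξ.1, pi_pos]) h02 hξ.2.le
    have h3 : 1 / sin y0 ^ 2 ≤ 1 / sin ξ ^ 2 := by gcongr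
    rw [eq_div_iff (by linarith)] at hξ2
    have e : (y - y0) / sin y0 ^ 2 = (y - y0) * (1 / sin y0 ^ 2) := by ring
    rw [e]; nlinarith
  · rw [h]; simp
  · obtain ⟨ξ, hξ, hξ2⟩ := exists_hasDerivAt_eq_slope cot (fun x => -(1 / sin x ^ 2)) h
      (fun x hx => (hder x (h0.trans_le hx.1) (hx.2.trans hy2)).continuousAt.continuousWithinAt)
      (fun x hx => hder x (h0.trans hx.1) (hx.2.le.trans hy2))
    have : sin y0 ≤ sin ξ := sin_le_sin_of_le_of_le_pi_div_two (by linarith [hξ.1, pi_pos])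
      (by linarith [hξ.2]) hξ.1.le
    have h3 : 1 / sin ξ ^ 2 ≤ 1 / sin y0 ^ 2 := by gcongr
    rw [eq_div_iff (by linarith)] at hξ2
    have e : (y - y0) / sin y0 ^ 2 = (y - y0) * (1 / sin y0 ^ 2) := by ring
    rw [e]; nlinarith

lemma step_pos (H : Sol L s a u v) (hvL : v L = 0) {c y0 : ℝ} (h0 : 0 < y0) (h02 : y0 ≤ π / 2)
    (hc : 0 ≤ c) (hcL : c < L) (hvc : v c = 0) (huc : 0 < u c) :
    ∃ e, c < e ∧ e ≤ L ∧ v e = 0 ∧ u e ≠ 0 ∧ s * (e - c) ≤ π ∧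
      (s * (e - c) = π → ∫ x in c..e, (a x - s^2) = 0) ∧
      2 * s * cot y0 - s * (s * (e - c) - 2 * y0) / sin y0 ^ 2 ≤ ∫ x in c..e, (a x - s^2) := by
  have hs := H.hs
  obtain ⟨d, hcd, hdL, hud, hpos⟩ := first_zero (H.hu' hc le_rfl) huc (by
    by_contra hcon
    push Not at hcon
    have := H.v_lt hc hcL le_rfl (fun x hx => hcon x ⟨hx.1.le, hx.2.le⟩)
    rw [hvL, hvc] at this; exact lt_irrefl _ this)
  have hvd : v d < 0 := by
    rw [← hvc]; exact H.v_lt hc hcd hdL (fun x hx => hpos x ⟨hx.1.le, hx.2⟩)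
  have hd0 : 0 ≤ d := by linarith
  obtain ⟨e, hde, heL, hve, hneg⟩ := first_zero (f := fun x => - v x) (H.hv' hd0 le_rfl).neg
    (by linarith) ⟨L, ⟨hdL, le_rfl⟩, by simp [hvL]⟩
  have hve : v e = 0 := by simpa using hve
  have une : ∀ x, d < x → x ≤ e → u x < 0 := by
    intro x hx hxe
    rw [H.h1 d ⟨hd0, hdL⟩ x ⟨by linarith, by linarith⟩, hud, zero_add]
    have : 0 < ∫ t in d..x, - v t := by
      apply intervalIntegral.intervalIntegral_pos_of_pos_on _ _ hx
      · apply ContinuousOn.intervalIntegrable; rw [uIcc_of_le hx.le]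
        exact (H.hv' hd0 (by linarith)).neg
      · intro y hy; exact hneg y ⟨hy.1.le, hy.2.trans_le hxe⟩
    rw [intervalIntegral.integral_neg] at this
    linarith
  obtain ⟨p1, p2, p3⟩ := H.piece hc hcd hdL hpos hvc hud
  obtain ⟨q1, q2, q3⟩ := H.reflect.piece (c := L - e) (d := L - d) (by linarith) (by linarith)
    (by linarith) (fun x hx => by
      have := une (L - x) (by linarith [hx.2]) (by linarith [hx.1]); simpa using this)
    (by simpa using hve) (by simpa using hud)
  have er : (∫ x in (L-e)..(L-d), (a (L - x) - s^2)) = ∫ x in d..e, (a x - s^2) := by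
    rw [intervalIntegral.integral_comp_sub_left (fun x => a x - s^2)]; simp
  have el : L - d - (L - e) = e - d := by ring
  rw [er, el] at q3
  rw [er, el] at q2
  rw [el] at q1
  have add : (∫ x in c..e, (a x - s^2)) = (∫ x in c..d, (a x - s^2)) + ∫ x in d..e, (a x - s^2) :=
    (intervalIntegral.integral_add_adjacent_intervals (H.b_ii hc hcd.le hdL)
      (H.b_ii hd0 hde.le heL)).symm
  refine ⟨e, by linarith, heL, hve, (une e hde le_rfl).ne, by nlinarith, ?_, ?_⟩
  · intro h
    rw [add, p2 (by nlinarith), q2 (by nlinarith), add_zero]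
  · have t1 := cot_tangent (mul_pos hs (sub_pos.2 hcd)) p1 h0 h02
    have t2 := cot_tangent (mul_pos hs (sub_pos.2 hde)) q1 h0 h02
    have t1' := mul_le_mul_of_nonneg_left t1 hs.le
    have t2' := mul_le_mul_of_nonneg_left t2 hs.le
    have : 2 * s * cot y0 - s * (s * (e - c) - 2 * y0) / sin y0 ^ 2 =
      s * (cot y0 - (s * (d - c) - y0) / sin y0 ^ 2) +
      s * (cot y0 - (s * (e - d) - y0) / sin y0 ^ 2) := by ring
    rw [this, add]; linarith

lemma step (H : Sol L s a u v) (hvL : v L = 0) {c y0 : ℝ} (h0 : 0 < y0) (h02 : y0 ≤ π / 2)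
    (hc : 0 ≤ c) (hcL : c < L) (hvc : v c = 0) (huc : u c ≠ 0) :
    ∃ e, c < e ∧ e ≤ L ∧ v e = 0 ∧ u e ≠ 0 ∧ s * (e - c) ≤ π ∧
      (s * (e - c) = π → ∫ x in c..e, (a x - s^2) = 0) ∧
      2 * s * cot y0 - s * (s * (e - c) - 2 * y0) / sin y0 ^ 2 ≤ ∫ x in c..e, (a x - s^2) := by
  rcases lt_or_gt_of_ne huc with h | h
  · have := H.neg.step_pos (by simp [hvL]) h0 h02 hc hcL (by simp [hvc]) (by linarith)
    simpa using this
  · exact H.step_pos hvL h0 h02 hc hcL hvc h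

lemma lower (H : Sol L s a u v) (hL : 0 < L) {n : ℕ} (hn : 1 ≤ n) (hsL : s * L = n * π)
    (hv0 : v 0 = 0) (hvL : v L = 0) (hu0 : u 0 ≠ 0) (hne : ∫ x in (0:ℝ)..L, (a x - s^2) ≠ 0) :
    2 * ((n:ℝ) + 1) * s * cot (n * π / (2 * (n + 1))) ≤ ∫ x in (0:ℝ)..L, (a x - s^2) := by
  have hs := H.hs
  have hn' : (1:ℝ) ≤ n := by exact_mod_cast hn
  set y0 := (n:ℝ) * π / (2 * (n + 1)) with hy0
  have e0 : 2 * ((n:ℝ) + 1) * y0 = n * π := by rw [hy0]; field_simp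
  have h0 : 0 < y0 := by rw [hy0]; have := pi_pos; positivity
  have h02 : y0 ≤ π / 2 := by have := pi_pos; nlinarith
  have ind : ∀ k : ℕ, k ≤ n + 1 → ∃ x, 0 ≤ x ∧ x ≤ L ∧ v x = 0 ∧ u x ≠ 0 ∧ s * x ≤ k * π ∧
      (s * x = k * π → ∫ t in (0:ℝ)..x, (a t - s^2) = 0) ∧
      2 * k * s * cot y0 - s * (s * x - 2 * k * y0) / sin y0 ^ 2 ≤ ∫ t in (0:ℝ)..x, (a t - s^2) := by
    intro k
    induction k with
    | zero => intro _; exact ⟨0, le_rfl, hL.le, hv0, hu0, by simp, by simp, by simp⟩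
    | succ k ih =>
      intro hk
      obtain ⟨x, x0, xL, hvx, hux, hx1, hx2, hx3⟩ := ih (by omega)
      have hkn : (k:ℝ) ≤ n := by exact_mod_cast (by omega : k ≤ n)
      have xlt : x < L := by
        rcases xL.lt_or_eq with h | h
        · exact h
        · exfalso
          subst h
          apply hne
          apply hx2
          have := pi_pos
          apply le_antisymm hx1
          rw [hsL]; gcongr
      obtain ⟨e, he, heL, hve, hue, he1, he2, he3⟩ := H.step hvL h0 h02 x0 xlt hvx hux
      have add : (∫ t in (0:ℝ)..e, (a t - s^2)) =
          (∫ t in (0:ℝ)..x, (a t - s^2)) + ∫ t in x..e, (a t - s^2) :=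
        (intervalIntegral.integral_add_adjacent_intervals (H.b_ii le_rfl x0 xL)
          (H.b_ii x0 he.le heL)).symm
      refine ⟨e, by linarith, heL, hve, hue, ?_, ?_, ?_⟩
      · push_cast; linarith
      · intro h
        push_cast at h
        rw [add, hx2 (by linarith), he2 (by linarith), add_zero]
      · rw [add]
        push_cast
        have : 2 * ((k:ℝ) + 1) * s * cot y0 - s * (s * e - 2 * (k + 1) * y0) / sin y0 ^ 2 =
          (2 * k * s * cot y0 - s * (s * x - 2 * k * y0) / sin y0 ^ 2) +
          (2 * s * cot y0 - s * (s * (e - x) - 2 * y0) / sin y0 ^ 2) := by ring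
        rw [this]; linarith
  obtain ⟨x, x0, xL, -, -, -, -, hx3⟩ := ind (n + 1) le_rfl
  have add : (∫ t in (0:ℝ)..L, (a t - s^2)) =
      (∫ t in (0:ℝ)..x, (a t - s^2)) + ∫ t in x..L, (a t - s^2) :=
    (intervalIntegral.integral_add_adjacent_intervals (H.b_ii le_rfl x0 xL)
      (H.b_ii x0 xL le_rfl)).symm
  have nn := H.int_b_nonneg x0 xL le_rfl
  push_cast at hx3
  have : 0 ≤ - (s * (s * x - 2 * ((n:ℝ)+1) * y0) / sin y0 ^ 2) := by
    rw [← neg_div]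
    apply div_nonneg _ (sq_nonneg _)
    rw [e0, ← hsL]
    have : s * x ≤ s * L := mul_le_mul_of_nonneg_left xL hs.le
    nlinarith
  linarith

end Sol

section reg
variable {L : ℝ} {a u v : ℝ → ℝ}

lemma reg_cont {x : ℝ} (hx0 : 0 ≤ x) (hxL : x ≤ L)
    (h1 : ∀ x ∈ Icc (0:ℝ) L, u x = u 0 + ∫ t in (0:ℝ)..x, v t)
    (h2 : ∀ x ∈ Icc (0:ℝ) L, v x = - ∫ t in (0:ℝ)..x, a t * u t)
    (hP : IntervalIntegrable (fun t => a t * u t) volume 0 x) :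
    ContinuousOn v (Icc 0 x) ∧ ContinuousOn u (Icc 0 x) := by
  have sub : Icc 0 x ⊆ Icc 0 L := Icc_subset_Icc le_rfl hxL
  have cv : ContinuousOn v (Icc 0 x) := by
    have := (intervalIntegral.continuousOn_primitive_interval' hP (a := 0) (by simp)).neg
    rw [uIcc_of_le hx0] at this
    exact this.congr (fun y hy => h2 y (sub hy))
  have iv : IntervalIntegrable v volume 0 x := by
    apply ContinuousOn.intervalIntegrable; rwa [uIcc_of_le hx0]
  refine ⟨cv, ?_⟩
  have := (intervalIntegral.continuousOn_primitive_interval' iv (a := 0) (by simp))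
  rw [uIcc_of_le hx0] at this
  exact (continuousOn_const.add this).congr (fun y hy => h1 y (sub hy))

lemma reg_bound {c x δ : ℝ} (hc : 0 ≤ c) (hcx : c ≤ x) (hxL : x ≤ L)
    (ha : IntervalIntegrable a volume 0 L)
    (hδ0 : 0 < δ) (hδ : δ * (∫ t in (0:ℝ)..L, |a t|) ≤ 1 / 2) (hcd : x - c ≤ δ)
    (h1 : ∀ x ∈ Icc (0:ℝ) L, u x = u 0 + ∫ t in (0:ℝ)..x, v t)
    (h2 : ∀ x ∈ Icc (0:ℝ) L, v x = - ∫ t in (0:ℝ)..x, a t * u t)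
    (hP : IntervalIntegrable (fun t => a t * u t) volume 0 x) :
    ∀ y ∈ Icc c x, |u y| ≤ 2 * (|u c| + δ * |v c|) := by
  have hx0 : 0 ≤ x := hc.trans hcx
  obtain ⟨cv, cu⟩ := reg_cont hx0 hxL h1 h2 hP
  set A := ∫ t in (0:ℝ)..L, |a t|
  have cu' : ContinuousOn (fun y => |u y|) (Icc c x) := (cu.mono (Icc_subset_Icc hc le_rfl)).abs
  obtain ⟨m, hm, hmax⟩ := isCompact_Icc.exists_isMaxOn (nonempty_Icc.2 hcx) cu'
  have hmax : ∀ y ∈ Icc c x, |u y| ≤ |u m| := fun y hy => hmax hy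
  have iau : ∀ p q, 0 ≤ p → p ≤ q → q ≤ x →
      IntervalIntegrable (fun t => a t * u t) volume p q := by
    intro p q hp hpq hq
    apply hP.mono_set
    rw [uIcc_of_le hpq, uIcc_of_le hx0]; exact Icc_subset_Icc hp hq
  have iv : ∀ p q, 0 ≤ p → p ≤ q → q ≤ x → IntervalIntegrable v volume p q := by
    intro p q hp hpq hq
    apply ContinuousOn.intervalIntegrable
    rw [uIcc_of_le hpq]; exact cv.mono (Icc_subset_Icc hp hq)
  have ia : ∀ p q, 0 ≤ p → p ≤ q → q ≤ x →
      IntervalIntegrable (fun t => |a t|) volume p q := by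
    intro p q hp hpq hq
    apply ha.abs.mono_set
    rw [uIcc_of_le hpq, uIcc_of_le (hx0.trans hxL)]; exact Icc_subset_Icc hp (hq.trans hxL)
  have hv : ∀ y ∈ Icc c x, |v y| ≤ |v c| + |u m| * A := by
    intro y hy
    have e : v y = v c - ∫ t in c..y, a t * u t := by
      rw [h2 y ⟨hc.trans hy.1, hy.2.trans hxL⟩, h2 c ⟨hc, hcx.trans hxL⟩,
        ← intervalIntegral.integral_add_adjacent_intervals (iau 0 c le_rfl hc hcx)
          (iau c y hc hy.1 hy.2)]; ring
    have i1 : |∫ t in c..y, a t * u t| ≤ ∫ t in c..y, |a t| * |u m| := by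
      refine (intervalIntegral.abs_integral_le_integral_abs hy.1).trans ?_
      apply intervalIntegral.integral_mono_on hy.1 (iau c y hc hy.1 hy.2).abs
        ((ia c y hc hy.1 hy.2).mul_const _)
      intro t ht
      rw [abs_mul]
      exact mul_le_mul_of_nonneg_left (hmax t ⟨ht.1, ht.2.trans hy.2⟩) (abs_nonneg _)
    have i2 : ∫ t in c..y, |a t| ≤ A := by
      apply intervalIntegral.integral_mono_interval hc hy.1 (hy.2.trans hxL) _ ha.abs
      exact Filter.Eventually.of_forall (fun t => abs_nonneg _)
    rw [intervalIntegral.integral_mul_const] at i1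
    have i3 : |v c - ∫ t in c..y, a t * u t| ≤ |v c| + |∫ t in c..y, a t * u t| := abs_sub _ _
    rw [e]
    have := mul_le_mul_of_nonneg_right i2 (abs_nonneg (u m))
    linarith
  have hu : |u m| ≤ |u c| + δ * (|v c| + |u m| * A) := by
    have e : u m = u c + ∫ t in c..m, v t := by
      rw [h1 m ⟨hc.trans hm.1, hm.2.trans hxL⟩, h1 c ⟨hc, hcx.trans hxL⟩,
        ← intervalIntegral.integral_add_adjacent_intervals (iv 0 c le_rfl hc hcx)
          (iv c m hc hm.1 hm.2)]; ring
    have i1 : |∫ t in c..m, v t| ≤ (|v c| + |u m| * A) * |m - c| := by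
      have := intervalIntegral.norm_integral_le_of_norm_le_const (a := c) (b := m) (f := v)
        (C := |v c| + |u m| * A) (fun t ht => by
          rw [uIoc_of_le hm.1] at ht
          exact hv t ⟨ht.1.le, ht.2.trans hm.2⟩)
      simpa using this
    have i2 : |m - c| ≤ δ := by rw [abs_of_nonneg (by linarith [hm.1])]; linarith [hm.2]
    have A0 : 0 ≤ |v c| + |u m| * A := (abs_nonneg _).trans (hv c ⟨le_rfl, hcx⟩)
    have i3 := abs_add_le (u c) (∫ t in c..m, v t)
    rw [← e] at i3
    have := mul_le_mul_of_nonneg_left i2 A0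
    linarith
  intro y hy
  have h3 := mul_le_mul_of_nonneg_left hδ (abs_nonneg (u m))
  have := hmax y hy
  nlinarith

lemma exists_delta (hL : 0 < L) (a : ℝ → ℝ) :
    ∃ δ, 0 < δ ∧ δ * (∫ t in (0:ℝ)..L, |a t|) ≤ 1 / 2 := by
  have : 0 ≤ ∫ t in (0:ℝ)..L, |a t| :=
    intervalIntegral.integral_nonneg hL.le (fun t _ => abs_nonneg _)
  refine ⟨1 / (2 * ((∫ t in (0:ℝ)..L, |a t|) + 1)), by positivity, ?_⟩
  rw [div_mul_eq_mul_div, div_le_div_iff₀ (by positivity) (by positivity)]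
  linarith

lemma reg_integrable (hL : 0 < L) (ha : IntervalIntegrable a volume 0 L)
    (h1 : ∀ x ∈ Icc (0:ℝ) L, u x = u 0 + ∫ t in (0:ℝ)..x, v t)
    (h2 : ∀ x ∈ Icc (0:ℝ) L, v x = - ∫ t in (0:ℝ)..x, a t * u t) :
    IntervalIntegrable (fun t => a t * u t) volume 0 L := by
  obtain ⟨δ, hδ0, hδ⟩ := exists_delta hL a
  set S : Set ℝ := {x | x ∈ Icc 0 L ∧ IntervalIntegrable (fun t => a t * u t) volume 0 x} with hS
  have h0S : (0:ℝ) ∈ S := ⟨⟨le_rfl, hL.le⟩, by simp⟩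
  have bdd : BddAbove S := ⟨L, fun x hx => hx.1.2⟩
  set t := sSup S with ht
  have t0 : 0 ≤ t := le_csSup bdd h0S
  have tL : t ≤ L := csSup_le ⟨0, h0S⟩ (fun x hx => hx.1.2)
  have Plt : ∀ x, 0 ≤ x → x < t → IntervalIntegrable (fun t => a t * u t) volume 0 x := by
    intro x hx hxt
    obtain ⟨y, hy, hxy⟩ := exists_lt_of_lt_csSup ⟨0, h0S⟩ hxt
    apply hy.2.mono_set
    rw [uIcc_of_le hx, uIcc_of_le hy.1.1]; exact Icc_subset_Icc le_rfl hxy.le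
  have Pt : IntervalIntegrable (fun t => a t * u t) volume 0 t := by
    rcases t0.lt_or_eq with tpos | h
    swap
    · rw [← h]
    have cu : ContinuousOn u (Ico 0 t) := by
      intro y hy
      have hyt : y < (y + t) / 2 := by linarith [hy.2]
      have := (reg_cont (x := (y + t) / 2) (by linarith [hy.1]) (by linarith [hy.2]) h1 h2
        (Plt _ (by linarith [hy.1]) (by linarith [hy.2]))).2 y ⟨hy.1, hyt.le⟩
      apply this.mono_of_mem_nhdsWithin
      have h3 : Iio ((y + t) / 2) ∈ nhdsWithin y (Ico 0 t) := mem_nhdsWithin_of_mem_nhds (Iio_mem_nhds hyt)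
      filter_upwards [h3, self_mem_nhdsWithin] with z hz hz2
      exact ⟨hz2.1, le_of_lt hz⟩
    set c := max (t - δ) 0 with hcdef
    have c0 : 0 ≤ c := le_max_right _ _
    have ct : c < t := max_lt (by linarith) tpos
    have cd : t - δ ≤ c := le_max_left _ _
    have cu0 := (reg_cont c0 (by linarith) h1 h2 (Plt c c0 ct)).2
    obtain ⟨K, hK⟩ := isCompact_Icc.exists_bound_of_continuousOn cu0
    have bd : ∀ y ∈ Ico 0 t, ‖u y‖ ≤ max K (2 * (|u c| + δ * |v c|)) := by
      intro y hy
      rcases le_total y c with h | h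
      · exact (hK y ⟨hy.1, h⟩).trans (le_max_left _ _)
      · exact (reg_bound c0 h (hy.2.le.trans tL) ha hδ0 hδ (by linarith [hy.2]) h1 h2
          (Plt y hy.1 hy.2) y ⟨h, le_rfl⟩).trans (le_max_right _ _)
    rw [intervalIntegrable_iff_integrableOn_Ico_of_le t0]
    have ia : IntegrableOn a (Ico 0 t) := by
      rw [← intervalIntegrable_iff_integrableOn_Ico_of_le t0]
      apply ha.mono_set
      rw [uIcc_of_le t0, uIcc_of_le hL.le]; exact Icc_subset_Icc le_rfl tL
    refine Integrable.mul_bdd (c := max K (2 * (|u c| + δ * |v c|))) ia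
      (cu.aestronglyMeasurable measurableSet_Ico) ?_
    filter_upwards [ae_restrict_mem measurableSet_Ico] with y hy
    exact bd y hy
  have cv := (reg_cont t0 tL h1 h2 Pt).1
  have iv1 : IntervalIntegrable v volume 0 t := by
    apply ContinuousOn.intervalIntegrable; rwa [uIcc_of_le t0]
  have iv2 : IntervalIntegrable v volume t L := by
    have : IntervalIntegrable (fun _ : ℝ => (0:ℝ)) volume t L := intervalIntegrable_const
    apply this.congr
    intro x hx
    rw [uIoc_of_le tL] at hx
    have hxI : x ∈ Icc 0 L := ⟨by linarith [hx.1], hx.2⟩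
    simp only
    rw [h2 x hxI, intervalIntegral.integral_undef, neg_zero]
    intro hcon
    have := le_csSup bdd (show x ∈ S from ⟨hxI, hcon⟩)
    linarith [hx.1]
  have iv := iv1.trans iv2
  have cu : ContinuousOn u (Icc 0 L) := by
    have := (intervalIntegral.continuousOn_primitive_interval' iv (a := 0) (by simp))
    rw [uIcc_of_le hL.le] at this
    exact (continuousOn_const.add this).congr (fun y hy => h1 y hy)
  apply ha.mul_continuousOn
  rwa [uIcc_of_le hL.le]

lemma reg_unique (hL : 0 < L) (ha : IntervalIntegrable a volume 0 L)
    (h1 : ∀ x ∈ Icc (0:ℝ) L, u x = u 0 + ∫ t in (0:ℝ)..x, v t)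
    (h2 : ∀ x ∈ Icc (0:ℝ) L, v x = - ∫ t in (0:ℝ)..x, a t * u t) (hu0 : u 0 = 0) :
    ∀ x ∈ Icc 0 L, u x = 0 := by
  obtain ⟨δ, hδ0, hδ⟩ := exists_delta hL a
  have hP := reg_integrable hL ha h1 h2
  have ind : ∀ k : ℕ, ∀ x ∈ Icc 0 L, x ≤ k * δ → u x = 0 := by
    intro k
    induction k with
    | zero =>
      intro x hx hxk
      have : x = 0 := le_antisymm (by simpa using hxk) hx.1
      rw [this, hu0]
    | succ k ih =>
      intro x hx hxk
      push_cast at hxk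
      rcases le_total x (k * δ) with h | h
      · exact ih x hx h
      set c := (k:ℝ) * δ with hc
      have c0 : 0 ≤ c := by positivity
      have cL : c ≤ L := h.trans hx.2
      have uc : u c = 0 := ih c ⟨c0, cL⟩ le_rfl
      have vc : v c = 0 := by
        rw [h2 c ⟨c0, cL⟩, intervalIntegral.integral_congr (g := fun _ => 0)]
        · simp
        · intro y hy
          rw [uIcc_of_le c0] at hy
          simp only
          rw [ih y ⟨hy.1, hy.2.trans cL⟩ hy.2, mul_zero]
      have := reg_bound c0 h hx.2 ha hδ0 hδ (by linarith) h1 h2 (hP.mono_set (by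
        rw [uIcc_of_le hx.1, uIcc_of_le hL.le]; exact Icc_subset_Icc le_rfl hx.2)) x ⟨h, le_rfl⟩
      rw [uc, vc] at this
      simp at this
      exact this
  intro x hx
  obtain ⟨k, hk⟩ := exists_nat_ge (x / δ)
  exact ind k x hx (by rwa [div_le_iff₀ hδ0] at hk)

lemma mkSol (hL : 0 < L) {s : ℝ} (hs : 0 < s) (ha : IntervalIntegrable a volume 0 L)
    (hab : ∀ᵐ x ∂(volume.restrict (Ioo 0 L)), s ^ 2 ≤ a x)
    (h1 : ∀ x ∈ Icc (0:ℝ) L, u x = u 0 + ∫ t in (0:ℝ)..x, v t)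
    (h2 : ∀ x ∈ Icc (0:ℝ) L, v x = - ∫ t in (0:ℝ)..x, a t * u t) : Sol L s a u v := by
  have hP := reg_integrable hL ha h1 h2
  obtain ⟨cv, cu⟩ := reg_cont hL.le le_rfl h1 h2 hP
  have iv : IntervalIntegrable v volume 0 L := by
    apply ContinuousOn.intervalIntegrable; rwa [uIcc_of_le hL.le]
  have sub : ∀ x ∈ Icc 0 L, uIcc 0 x ⊆ uIcc 0 L := fun x hx => by
    rw [uIcc_of_le hx.1, uIcc_of_le hL.le]; exact Icc_subset_Icc le_rfl hx.2
  refine ⟨hs, ha, cu, cv, ?_, ?_, (ae_restrict_iff' measurableSet_Ioo).1 hab⟩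
  · intro x hx y hy
    rw [h1 y hy, h1 x hx, ← intervalIntegral.integral_interval_sub_left
      (iv.mono_set (sub y hy)) (iv.mono_set (sub x hx))]; ring
  · intro x hx y hy
    rw [h2 y hy, h2 x hx, intervalIntegral.integral_neg,
      ← intervalIntegral.integral_interval_sub_left
      (hP.mono_set (sub y hy)) (hP.mono_set (sub x hx))]; ring

end reg

section upper

/-- elementary bounds on `r = tan p * cot (q p)` -/
lemma ratio_bounds {q p : ℝ} (hq : 0 < q) (hq1 : q < 1) (hp : 0 < p) (hp2 : p < π / 2) :
    1 ≤ tan p * cot (q * p) ∧ tan p * cot (q * p) ≤ 1 / (q * cos p) ∧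
    ∀ p1, 0 < p1 → p1 ≤ p → tan p * cot (q * p) ≤ tan p * cot (q * p1) := by
  have qp : 0 < q * p := mul_pos hq hp
  have qpp : q * p < p := by nlinarith
  have cp : 0 < cos p := cos_pos_of_mem_Ioo ⟨by linarith, hp2⟩
  have sp : 0 < sin p := sin_pos_of_pos_of_lt_pi hp (by linarith)
  have cqp : 0 < cos (q * p) := cos_pos_of_mem_Ioo ⟨by linarith, by linarith⟩
  have sqp : 0 < sin (q * p) := sin_pos_of_pos_of_lt_pi qp (by linarith)
  have tq : 0 < tan (q * p) := tan_pos_of_pos_of_lt_pi_div_two qp (by linarith)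
  have tp : 0 < tan p := tan_pos_of_pos_of_lt_pi_div_two hp hp2
  have e : ∀ z : ℝ, cot z = 1 / tan z := fun z => by
    rw [cot_eq_cos_div_sin, tan_eq_sin_div_cos, one_div_div]
  refine ⟨?_, ?_, ?_⟩
  · rw [e, mul_one_div, le_div_iff₀ tq, one_mul]
    exact (tan_lt_tan_of_nonneg_of_lt_pi_div_two qp.le hp2 qpp).le
  · rw [e, mul_one_div, div_le_div_iff₀ tq (by positivity)]
    have h1 : q * p ≤ tan (q * p) := le_tan qp.le (by linarith)
    have h2 : tan p * (q * cos p) = q * sin p := by rw [tan_eq_sin_div_cos]; field_simp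
    have h3 : sin p ≤ p := sin_le hp.le
    rw [h2]; nlinarith
  · intro p1 h1 h2
    apply mul_le_mul_of_nonneg_left _ tp.le
    rw [e, e]
    have : 0 < tan (q * p1) := tan_pos_of_pos_of_lt_pi_div_two (mul_pos hq h1) (by nlinarith)
    apply one_div_le_one_div_of_le this
    rcases h2.lt_or_eq with h | h
    · apply (tan_lt_tan_of_nonneg_of_lt_pi_div_two (mul_pos hq h1).le (by linarith) _).le
      nlinarith
    · rw [h]

/-- the smoothed potential minus its base value, bounds at one point; `p` is the angle. -/
lemma b_bounds {q p p1 X : ℝ} (hX : 0 ≤ X) (hq : 0 < q) (hq1 : q < 1) (hp : p ≠ 0)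
    (hpl : -(π/2) < p) (hpr : p < π / 2) (h1 : 0 < p1) (h12 : p1 < π / 2) :
    q * (1 - q) * X ≤ X * (q * (tan p * cot (q * p)) - q ^ 2) ∧
    X * (q * (tan p * cot (q * p)) - q ^ 2) ≤ q * cot (q * p1) * (X * |tan p|) + X * (cos p)⁻¹ ∧
    X * (q * (tan p * cot (q * p)) - q ^ 2) ≤ q * cot (q * p1) * (X * |tan p|) + 
      (if |p| ≤ p1 then X * (cos p1)⁻¹ else 0) := by
  wlog hpos : 0 < p generalizing p
  · have := this (p := -p) (by simpa using hp) (by linarith) (by linarith) (by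
      have := lt_of_le_of_ne (not_lt.1 hpos) hp; linarith)
    have ec : ∀ z : ℝ, cot (-z) = - cot z := fun z => by
      rw [cot_eq_cos_div_sin, cot_eq_cos_div_sin, cos_neg, sin_neg, div_neg]
    simpa [ec] using this
  obtain ⟨a1, a2, a3⟩ := ratio_bounds hq hq1 hpos hpr
  have tp : 0 < tan p := tan_pos_of_pos_of_lt_pi_div_two hpos hpr
  have cp : 0 < cos p := cos_pos_of_mem_Ioo ⟨by linarith, hpr⟩
  have cp1 : 0 < cos p1 := cos_pos_of_mem_Ioo ⟨by linarith, h12⟩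
  have cot1 : 0 < cot (q * p1) := by
    rw [cot_eq_cos_div_sin]
    have : q * p1 < p1 := by nlinarith
    have h0 : 0 < q * p1 := by positivity
    exact div_pos (cos_pos_of_mem_Ioo ⟨by linarith, by linarith⟩)
      (sin_pos_of_pos_of_lt_pi h0 (by linarith))
  rw [abs_of_pos tp, abs_of_pos hpos]
  have b2 : X * (q * (tan p * cot (q * p)) - q ^ 2) ≤ X * (cos p)⁻¹ := by
    apply mul_le_mul_of_nonneg_left _ hX
    have : q * (tan p * cot (q * p)) ≤ q * (1 / (q * cos p)) := mul_le_mul_of_nonneg_left a2 hq.le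
    have e : q * (1 / (q * cos p)) = (cos p)⁻¹ := by field_simp
    nlinarith
  have nn : 0 ≤ q * cot (q * p1) * (X * tan p) := by positivity
  refine ⟨?_, by linarith, ?_⟩
  · have : q * (1 - q) ≤ q * (tan p * cot (q * p)) - q ^ 2 := by nlinarith
    nlinarith
  · split_ifs with h
    · have : (cos p)⁻¹ ≤ (cos p1)⁻¹ := by
        apply inv_anti₀ cp1
        exact cos_le_cos_of_nonneg_of_le_pi hpos.le (by linarith) h
      have := mul_le_mul_of_nonneg_left this hX
      linarith
    · have := mul_le_mul_of_nonneg_left (mul_le_mul_of_nonneg_left (a3 p1 h1 (not_le.1 h).le) hq.le) hX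
      nlinarith [mul_nonneg hX (sq_nonneg q)]

variable {k ω : ℝ}

/-- the angle -/
noncomputable def ang (k ω x : ℝ) : ℝ := arcsin (k * cos (ω * x))
noncomputable def ang1 (k ω x : ℝ) : ℝ := -(k * ω * sin (ω * x)) / cos (ang k ω x)
noncomputable def ang2 (k ω x : ℝ) : ℝ :=
  -(ω ^ 2 * (1 - k ^ 2)) * sin (ang k ω x) / cos (ang k ω x) ^ 3

lemma kc_lt (hk : 0 < k) (hk1 : k < 1) (y : ℝ) : -1 < k * cos y ∧ k * cos y < 1 := by
  have h1 := neg_one_le_cos y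
  have h2 := cos_le_one y
  constructor <;> nlinarith

lemma sin_ang (hk : 0 < k) (hk1 : k < 1) (x : ℝ) : sin (ang k ω x) = k * cos (ω * x) :=
  sin_arcsin (kc_lt hk hk1 _).1.le (kc_lt hk hk1 _).2.le

lemma ang_mem (hk : 0 < k) (hk1 : k < 1) (x : ℝ) : ang k ω x ∈ Ioo (-(π/2)) (π/2) :=
  ⟨neg_pi_div_two_lt_arcsin.2 (kc_lt hk hk1 _).1, arcsin_lt_pi_div_two.2 (kc_lt hk hk1 _).2⟩

lemma cos_ang_pos (hk : 0 < k) (hk1 : k < 1) (x : ℝ) : 0 < cos (ang k ω x) :=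
  cos_pos_of_mem_Ioo (ang_mem hk hk1 x)

lemma ang_deriv (hk : 0 < k) (hk1 : k < 1) (x : ℝ) :
    HasDerivAt (ang k ω) (ang1 k ω x) x := by
  have h := kc_lt hk hk1 (ω * x)
  have h1 : HasDerivAt (fun x : ℝ => ω * x) ω x := by simpa using (hasDerivAt_id x).const_mul ω
  have := (hasDerivAt_arcsin h.1.ne' h.2.ne).comp x (h1.cos.const_mul k)
  convert! this using 1
  rw [ang1, ang, cos_arcsin]; ring

lemma ang1_deriv (hk : 0 < k) (hk1 : k < 1) (x : ℝ) :
    HasDerivAt (ang1 k ω) (ang2 k ω x) x := by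
  have h1 : HasDerivAt (fun x : ℝ => ω * x) ω x := by simpa using (hasDerivAt_id x).const_mul ω
  have hX := (cos_ang_pos (ω := ω) hk hk1 x)
  have := ((h1.sin.const_mul (k * ω)).neg).div (ang_deriv (ω := ω) hk hk1 x).cos hX.ne'
  convert! this using 1
  rw [ang2, ang1]
  have hs := sin_ang (ω := ω) hk hk1 x
  have h3 := sin_sq_add_cos_sq (ang k ω x)
  have h4 := sin_sq_add_cos_sq (ω * x)
  simp only [Pi.neg_apply, Function.comp_apply]
  rw [eq_div_iff (by positivity)]
  field_simp
  rw [hs] at h3 ⊢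
  have h5 : cos (ang k ω x) ^ 2 = 1 - (k * cos (ω * x)) ^ 2 := by linarith
  have h6 : sin (ω * x) ^ 2 = 1 - cos (ω * x) ^ 2 := by linarith
  simp only [h5, h6]
  ring

lemma ang1_sq (hk : 0 < k) (hk1 : k < 1) (x : ℝ) :
    ang1 k ω x ^ 2 = ω ^ 2 - ω ^ 2 * (1 - k ^ 2) / cos (ang k ω x) ^ 2 := by
  have hX := (cos_ang_pos (ω := ω) hk hk1 x)
  have hs := sin_ang (ω := ω) hk hk1 x
  have h3 := sin_sq_add_cos_sq (ang k ω x)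
  have h4 := sin_sq_add_cos_sq (ω * x)
  rw [hs] at h3
  rw [ang1]
  field_simp
  have h5 : cos (ang k ω x) ^ 2 = 1 - (k * cos (ω * x)) ^ 2 := by linarith
  have h6 : sin (ω * x) ^ 2 = 1 - cos (ω * x) ^ 2 := by linarith
  simp only [h5, h6]
  ring

lemma ang_cont (hk : 0 < k) (hk1 : k < 1) : Continuous (ang k ω) :=
  continuous_iff_continuousAt.2 fun x => (ang_deriv hk hk1 x).continuousAt
lemma ang1_cont (hk : 0 < k) (hk1 : k < 1) : Continuous (ang1 k ω) :=
  continuous_iff_continuousAt.2 fun x => (ang1_deriv hk hk1 x).continuousAt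
lemma ang2_cont (hk : 0 < k) (hk1 : k < 1) : Continuous (ang2 k ω) := by
  have := ang_cont (ω := ω) hk hk1
  unfold ang2
  apply Continuous.div (by fun_prop) (by fun_prop)
  intro x; exact (pow_pos (cos_ang_pos hk hk1 x) 3).ne'

lemma int_ang2 (hk : 0 < k) (hk1 : k < 1) (hω : 0 < ω) (m : ℕ) :
    ∫ x in (0:ℝ)..(m * (π / ω)), |ang2 k ω x| = 2 * m * (k * ω) := by
  have hc := ang2_cont (ω := ω) hk hk1
  have hper : Function.Periodic (fun x => |ang2 k ω x|) (π / ω) := by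
    intro x
    have : ang k ω (x + π / ω) = - ang k ω x := by
      rw [ang, ang, mul_add, mul_div_cancel₀ _ hω.ne', cos_add_pi, mul_neg, arcsin_neg]
    simp only [ang2, this, sin_neg, cos_neg, mul_neg, neg_div, abs_neg]
  have := hper.intervalIntegral_add_zsmul_eq m 0 (fun a b => hc.abs.intervalIntegrable a b)
  simp only [zero_add, zsmul_eq_mul, Int.cast_natCast] at this
  rw [this]
  have hpi := pi_pos
  have hh : 0 < π / 2 / ω := by positivity
  have hh2 : π / 2 / ω < π / ω := by gcongr; linarith
  have k1 : 0 < 1 - k ^ 2 := by nlinarith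
  have sgn : ∀ x, 0 ≤ cos (ω * x) → |ang2 k ω x| = - ang2 k ω x := by
    intro x hx
    apply abs_of_nonpos
    rw [ang2, sin_ang hk hk1]
    have := cos_ang_pos (ω := ω) hk hk1 x
    rw [neg_mul, neg_div]
    apply neg_nonpos.2; positivity
  have sgn2 : ∀ x, cos (ω * x) ≤ 0 → |ang2 k ω x| = ang2 k ω x := by
    intro x hx
    apply abs_of_nonneg
    rw [ang2, sin_ang hk hk1]
    have := cos_ang_pos (ω := ω) hk hk1 x
    have h3 : 0 ≤ - cos (ω * x) := by linarith
    have : -(ω ^ 2 * (1 - k ^ 2)) * (k * cos (ω * x)) / cos (ang k ω x) ^ 3 =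
      (ω ^ 2 * (1 - k ^ 2)) * (k * - cos (ω * x)) / cos (ang k ω x) ^ 3 := by ring
    rw [this]; positivity
  rw [← intervalIntegral.integral_add_adjacent_intervals (b := π / 2 / ω)
    (hc.abs.intervalIntegrable _ _) (hc.abs.intervalIntegrable _ _)]
  have i1 : ∫ x in (0:ℝ)..(π / 2 / ω), |ang2 k ω x| = ∫ x in (0:ℝ)..(π / 2 / ω), - ang2 k ω x := by
    apply intervalIntegral.integral_congr
    intro x hx
    rw [uIcc_of_le hh.le] at hx
    apply sgn
    have : ω * x ≤ π / 2 := by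
      have := mul_le_mul_of_nonneg_left hx.2 hω.le
      rwa [mul_div_cancel₀ _ hω.ne'] at this
    apply cos_nonneg_of_mem_Icc
    exact ⟨by linarith [mul_nonneg hω.le hx.1], this⟩
  have i2 : ∫ x in (π / 2 / ω)..(π / ω), |ang2 k ω x| = ∫ x in (π / 2 / ω)..(π / ω), ang2 k ω x := by
    apply intervalIntegral.integral_congr
    intro x hx
    rw [uIcc_of_le hh2.le] at hx
    apply sgn2
    have h1 : ω * x ≤ π := by
      have := mul_le_mul_of_nonneg_left hx.2 hω.le
      rwa [mul_div_cancel₀ _ hω.ne'] at this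
    have h2 : π / 2 ≤ ω * x := by
      have := mul_le_mul_of_nonneg_left hx.1 hω.le
      rwa [mul_div_cancel₀ _ hω.ne'] at this
    apply cos_nonpos_of_pi_div_two_le_of_le h2; linarith
  have ft : ∀ a b, ∫ x in a..b, ang2 k ω x = ang1 k ω b - ang1 k ω a := fun a b =>
    integral_eq_sub_of_hasDerivAt (fun x _ => ang1_deriv hk hk1 x) (hc.intervalIntegrable _ _)
  rw [i1, i2, intervalIntegral.integral_neg, ft, ft]
  have e1 : ang1 k ω 0 = 0 := by simp [ang1]
  have e2 : ang1 k ω (π / ω) = 0 := by simp [ang1, mul_div_cancel₀ _ hω.ne']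
  have e3 : ang1 k ω (π / 2 / ω) = - (k * ω) := by simp [ang1, ang, mul_div_cancel₀ _ hω.ne']
  rw [e1, e2, e3]; ring

end upper

section upper2
variable {k ω q : ℝ}

noncomputable def uu (k ω q x : ℝ) : ℝ := sin (q * ang k ω x)
noncomputable def vv (k ω q x : ℝ) : ℝ := q * (cos (q * ang k ω x) * ang1 k ω x)
noncomputable def ww (k ω q x : ℝ) : ℝ :=
  q * (cos (q * ang k ω x) * ang2 k ω x) - q ^ 2 * (sin (q * ang k ω x) * ang1 k ω x ^ 2)
noncomputable def aa (k ω q x : ℝ) : ℝ :=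
  if ang k ω x = 0 then (q * ω) ^ 2 else - ww k ω q x / uu k ω q x

lemma uu_deriv (hk : 0 < k) (hk1 : k < 1) (x : ℝ) : HasDerivAt (uu k ω q) (vv k ω q x) x := by
  have := ((ang_deriv (ω := ω) hk hk1 x).const_mul q).sin
  convert! this using 1
  rw [vv]; ring

lemma vv_deriv (hk : 0 < k) (hk1 : k < 1) (x : ℝ) : HasDerivAt (vv k ω q) (ww k ω q x) x := by
  have := ((((ang_deriv (ω := ω) hk hk1 x).const_mul q).cos).mul (ang1_deriv (ω := ω) hk hk1 x)).const_mul q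
  convert! this using 1
  rw [ww]; ring

lemma vv_cont (hk : 0 < k) (hk1 : k < 1) : Continuous (vv k ω q) :=
  continuous_iff_continuousAt.2 fun x => (vv_deriv hk hk1 x).continuousAt
lemma uu_cont (hk : 0 < k) (hk1 : k < 1) : Continuous (uu k ω q) :=
  continuous_iff_continuousAt.2 fun x => (uu_deriv hk hk1 x).continuousAt
lemma ww_cont (hk : 0 < k) (hk1 : k < 1) : Continuous (ww k ω q) := by
  have h0 := ang_cont (ω := ω) hk hk1
  have h1 := ang1_cont (ω := ω) hk hk1
  have h2 := ang2_cont (ω := ω) hk hk1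
  unfold ww; fun_prop

lemma sin_q_ne {p : ℝ} (hq : 0 < q) (hq1 : q < 1) (hp : p ≠ 0) (h : p ∈ Ioo (-(π/2)) (π/2)) :
    sin (q * p) ≠ 0 := by
  have hpi := pi_pos
  intro h0
  rw [sin_eq_zero_iff_of_lt_of_lt (by nlinarith [h.1]) (by nlinarith [h.2])] at h0
  rcases mul_eq_zero.1 h0 with h | h
  · exact hq.ne' h
  · exact hp h

lemma aa_mul_uu (hk : 0 < k) (hk1 : k < 1) (hq : 0 < q) (hq1 : q < 1) (x : ℝ) :
    aa k ω q x * uu k ω q x = - ww k ω q x := by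
  by_cases h : ang k ω x = 0
  · simp [uu, ww, ang2, h]
  · have : uu k ω q x ≠ 0 := sin_q_ne hq hq1 h (ang_mem hk hk1 x)
    rw [aa, if_neg h]; field_simp

lemma aa_sub (hk : 0 < k) (hk1 : k < 1) (hq : 0 < q) (hq1 : q < 1) {x : ℝ} (h : ang k ω x ≠ 0) :
    aa k ω q x - (q * ω) ^ 2 = (ω ^ 2 * (1 - k ^ 2) / cos (ang k ω x) ^ 2) *
      (q * (tan (ang k ω x) * cot (q * ang k ω x)) - q ^ 2) := by
  have hu : sin (q * ang k ω x) ≠ 0 := sin_q_ne hq hq1 h (ang_mem hk hk1 x)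
  have hc := (cos_ang_pos (ω := ω) hk hk1 x).ne'
  rw [aa, if_neg h, ww, uu, ang1_sq hk hk1, ang2, tan_eq_sin_div_cos, cot_eq_cos_div_sin]
  field_simp
  ring

lemma ang2_abs (hk : 0 < k) (hk1 : k < 1) (x : ℝ) :
    (ω ^ 2 * (1 - k ^ 2) / cos (ang k ω x) ^ 2) * |tan (ang k ω x)| = |ang2 k ω x| := by
  have hc := (cos_ang_pos (ω := ω) hk hk1 x)
  have k1 : 0 < 1 - k ^ 2 := by nlinarith
  have h0 : 0 ≤ ω ^ 2 * (1 - k ^ 2) / cos (ang k ω x) ^ 2 := by positivity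
  rw [← abs_of_nonneg h0, ← abs_mul, ang2, tan_eq_sin_div_cos, ← abs_neg]
  congr 1
  field_simp

lemma aa_bounds (hk : 0 < k) (hk1 : k < 1) (hq : 0 < q) (hq1 : q < 1) {p1 : ℝ} (h1 : 0 < p1)
    (h12 : p1 < π / 2) (x : ℝ) :
    (q * ω) ^ 2 ≤ aa k ω q x ∧
    aa k ω q x - (q * ω) ^ 2 ≤ q * cot (q * p1) * |ang2 k ω x| + ω ^ 2 * (1 - k ^ 2) / cos p1 ^ 3 := by
  have k1 : 0 < 1 - k ^ 2 := by nlinarith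
  have cp1 : 0 < cos p1 := cos_pos_of_mem_Ioo ⟨by linarith, h12⟩
  have hc := (cos_ang_pos (ω := ω) hk hk1 x)
  have cot1 : 0 < cot (q * p1) := by
    rw [cot_eq_cos_div_sin]
    have : q * p1 < p1 := by nlinarith
    have h0 : 0 < q * p1 := by positivity
    exact div_pos (cos_pos_of_mem_Ioo ⟨by linarith, by linarith⟩)
      (sin_pos_of_pos_of_lt_pi h0 (by linarith))
  by_cases h : ang k ω x = 0
  · have : aa k ω q x = (q * ω) ^ 2 := by rw [aa, if_pos h]
    rw [this]
    refine ⟨le_rfl, ?_⟩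
    rw [sub_self]; positivity
  · have hm := ang_mem (ω := ω) hk hk1 x
    have hX : 0 ≤ ω ^ 2 * (1 - k ^ 2) / cos (ang k ω x) ^ 2 := by positivity
    obtain ⟨b1, -, b3⟩ := b_bounds hX hq hq1 h hm.1 hm.2 h1 h12
    rw [← aa_sub hk hk1 hq hq1 h] at b1 b3
    rw [ang2_abs hk hk1] at b3
    refine ⟨?_, b3.trans ?_⟩
    · have : 0 ≤ q * (1 - q) * (ω ^ 2 * (1 - k ^ 2) / cos (ang k ω x) ^ 2) :=
        mul_nonneg (mul_nonneg hq.le (by linarith)) hX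
      linarith
    · gcongr
      split_ifs with hle
      · have : cos p1 ≤ cos (ang k ω x) := by
          rw [← cos_abs (ang k ω x)]
          exact cos_le_cos_of_nonneg_of_le_pi (abs_nonneg _) (by linarith [pi_pos]) hle
        calc _ ≤ ω ^ 2 * (1 - k ^ 2) / cos p1 ^ 2 * (cos p1)⁻¹ := by gcongr
          _ = _ := by field_simp
      · positivity

lemma aa_gt (hk : 0 < k) (hk1 : k < 1) (hω : 0 < ω) (hq : 0 < q) (hq1 : q < 1) {x : ℝ}
    (h : ang k ω x ≠ 0) : (q * ω) ^ 2 < aa k ω q x := by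
  have k1 : 0 < 1 - k ^ 2 := by nlinarith
  have hc := (cos_ang_pos (ω := ω) hk hk1 x)
  have hm := ang_mem (ω := ω) hk hk1 x
  have hX : 0 < ω ^ 2 * (1 - k ^ 2) / cos (ang k ω x) ^ 2 := by positivity
  have hpi := pi_pos
  obtain ⟨b1, -, -⟩ := b_bounds hX.le hq hq1 h hm.1 hm.2 (p1 := π / 4) (by linarith) (by linarith)
  rw [← aa_sub hk hk1 hq hq1 h] at b1
  have : 0 < q * (1 - q) * (ω ^ 2 * (1 - k ^ 2) / cos (ang k ω x) ^ 2) :=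
    mul_pos (mul_pos hq (by linarith)) hX
  linarith

lemma aa_meas (hk : 0 < k) (hk1 : k < 1) : Measurable (aa k ω q) := by
  have h0 := (ang_cont (ω := ω) hk hk1).measurable
  unfold aa
  apply Measurable.ite
  · exact h0 (measurableSet_singleton 0)
  · exact measurable_const
  · exact (ww_cont hk hk1).measurable.neg.div (uu_cont hk hk1).measurable

lemma upper_exists (hk : 0 < k) (hk1 : k < 1) (hω : 0 < ω) (hq : 0 < q) (hq1 : q < 1) {p1 : ℝ}
    (h1 : 0 < p1) (h12 : p1 < π / 2) (m : ℕ) {L lam : ℝ} (hL : 0 < L) (hωL : L = m * (π / ω))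
    (hlam : lam = (q * ω) ^ 2) :
    ∃ r : ℝ, (∃ a : ℝ → ℝ,
        IntegrableOn a (Ioo 0 L) ∧
        (∀ᵐ x ∂(volume.restrict (Ioo 0 L)), lam ≤ a x) ∧
        0 < volume (Ioo 0 L ∩ {x | lam < a x}) ∧
        (∃ u v : ℝ → ℝ,
          (∀ x ∈ Icc (0:ℝ) L, u x = u 0 + ∫ t in (0:ℝ)..x, v t) ∧
          (∀ x ∈ Icc (0:ℝ) L, v x = - ∫ t in (0:ℝ)..x, a t * u t) ∧
          v L = 0 ∧ (∃ x ∈ Icc (0:ℝ) L, u x ≠ 0)) ∧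
        r = ∫ x in (0:ℝ)..L, |a x - lam|) ∧
      r ≤ q * cot (q * p1) * (2 * m * ω * k) + L * (ω ^ 2 * (1 - k ^ 2) / cos p1 ^ 3) := by
  subst hlam
  have hpi := pi_pos
  have hb := fun x => aa_bounds (ω := ω) hk hk1 hq hq1 h1 h12 x
  have c2 := ang2_cont (ω := ω) hk hk1
  have cbd : Continuous (fun x => q * cot (q * p1) * |ang2 k ω x| +
      ω ^ 2 * (1 - k ^ 2) / cos p1 ^ 3) := by fun_prop
  have ii : IntervalIntegrable (aa k ω q) volume 0 L := by
    have i1 : IntervalIntegrable (fun x => aa k ω q x - (q * ω) ^ 2) volume 0 L := by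
      apply (cbd.intervalIntegrable 0 L).mono_fun
      · exact ((aa_meas hk hk1).sub_const _).aestronglyMeasurable
      · apply Filter.Eventually.of_forall
        intro x
        simp only [norm_eq_abs]
        rw [abs_of_nonneg (by linarith [(hb x).1])]
        exact (hb x).2.trans (le_abs_self _)
    have := i1.add (intervalIntegrable_const (c := (q * ω) ^ 2))
    simpa using this
  refine ⟨_, ⟨aa k ω q, ?_, ?_, ?_, ⟨uu k ω q, vv k ω q, ?_, ?_, ?_, ?_⟩, rfl⟩, ?_⟩
  · rwa [← intervalIntegrable_iff_integrableOn_Ioo_of_le hL.le]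
  · exact Filter.Eventually.of_forall (fun x => (hb x).1)
  · have hmin : 0 < min L (π / 2 / ω) := lt_min hL (by positivity)
    have sub : Ioo 0 (min L (π / 2 / ω)) ⊆ Ioo 0 L ∩ {x | (q * ω) ^ 2 < aa k ω q x} := by
      intro x hx
      refine ⟨⟨hx.1, hx.2.trans_le (min_le_left _ _)⟩, ?_⟩
      apply aa_gt hk hk1 hω hq hq1
      intro h0
      have hs := sin_ang (ω := ω) hk hk1 x
      rw [h0, sin_zero] at hs
      have h3 : ω * x < π / 2 := by
        have := hx.2.trans_le (min_le_right _ _)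
        rw [lt_div_iff₀ hω] at this; linarith
      have : 0 < cos (ω * x) := cos_pos_of_mem_Ioo ⟨by linarith [mul_pos hω hx.1], h3⟩
      have := mul_pos hk this
      linarith
    refine lt_of_lt_of_le ?_ (measure_mono sub)
    simpa using ⟨hL, by positivity⟩
  · intro x _
    rw [integral_eq_sub_of_hasDerivAt (fun x _ => uu_deriv hk hk1 x)
      ((vv_cont hk hk1).intervalIntegrable _ _)]; ring
  · intro x _
    simp only [aa_mul_uu hk hk1 hq hq1]
    rw [intervalIntegral.integral_neg, neg_neg,
      integral_eq_sub_of_hasDerivAt (fun x _ => vv_deriv hk hk1 x)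
      ((ww_cont hk hk1).intervalIntegrable _ _)]
    simp [vv, ang1]
  · have : ω * L = m * π := by rw [hωL]; field_simp
    simp [vv, ang1, this, sin_nat_mul_pi]
  · refine ⟨0, ⟨le_rfl, hL.le⟩, ?_⟩
    apply sin_q_ne hq hq1 _ (ang_mem hk hk1 0)
    intro h0
    have hs := sin_ang (ω := ω) hk hk1 0
    rw [h0] at hs
    simp at hs
    exact hk.ne' hs.symm
  · calc ∫ x in (0:ℝ)..L, |aa k ω q x - (q * ω) ^ 2|
        ≤ ∫ x in (0:ℝ)..L, (q * cot (q * p1) * |ang2 k ω x| +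
          ω ^ 2 * (1 - k ^ 2) / cos p1 ^ 3) := by
          apply intervalIntegral.integral_mono_on hL.le
            (ii.sub intervalIntegrable_const).abs (cbd.intervalIntegrable _ _)
          intro x _
          rw [abs_of_nonneg (by linarith [(hb x).1])]
          exact (hb x).2
      _ = _ := by
          rw [intervalIntegral.integral_add ((c2.abs.const_mul _).intervalIntegrable _ _)
            intervalIntegrable_const, intervalIntegral.integral_const_mul,
            intervalIntegral.integral_const, smul_eq_mul, sub_zero]
          congr 2
          rw [hωL, int_ang2 hk hk1 hω]; ring

end upper2

theorem lyapunov_constant_L1 (L : ℝ) (hL : 0 < L) (n : ℕ) (hn : 1 ≤ n) :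
    sInf {r : ℝ | ∃ a : ℝ → ℝ,
        IntegrableOn a (Ioo 0 L) ∧
        (∀ᵐ x ∂(volume.restrict (Ioo 0 L)), (n : ℝ) ^ 2 * π ^ 2 / L ^ 2 ≤ a x) ∧
        0 < volume (Ioo 0 L ∩ {x | (n : ℝ) ^ 2 * π ^ 2 / L ^ 2 < a x}) ∧
        (∃ u v : ℝ → ℝ,
          (∀ x ∈ Icc (0:ℝ) L, u x = u 0 + ∫ t in (0:ℝ)..x, v t) ∧
          (∀ x ∈ Icc (0:ℝ) L, v x = - ∫ t in (0:ℝ)..x, a t * u t) ∧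
          v L = 0 ∧ (∃ x ∈ Icc (0:ℝ) L, u x ≠ 0)) ∧
        r = ∫ x in (0:ℝ)..L, |a x - (n : ℝ) ^ 2 * π ^ 2 / L ^ 2|} =
      2 * π * n * (n + 1) / L * Real.cot ((n : ℝ) * π / (2 * ((n : ℝ) + 1))) := by
  have hpi := pi_pos
  have hn' : (1:ℝ) ≤ n := by exact_mod_cast hn
  set s : ℝ := n * π / L with hs
  have s0 : 0 < s := by rw [hs]; positivity
  have elam : (n : ℝ) ^ 2 * π ^ 2 / L ^ 2 = s ^ 2 := by rw [hs]; ring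
  have eB : 2 * π * n * (n + 1) / L * Real.cot ((n : ℝ) * π / (2 * ((n : ℝ) + 1))) =
      2 * ((n:ℝ) + 1) * s * cot (n * π / (2 * (n + 1))) := by rw [hs]; ring
  rw [eB, elam]
  set ω : ℝ := (n + 1) * π / L with hω
  set q : ℝ := n / (n + 1) with hq
  have ω0 : 0 < ω := by rw [hω]; positivity
  have q0 : 0 < q := by rw [hq]; positivity
  have q1 : q < 1 := by rw [hq, div_lt_one (by positivity)]; linarith
  have hqω : s ^ 2 = (q * ω) ^ 2 := by rw [hs, hω, hq]; field_simp
  have hLω : L = ((n + 1 : ℕ) : ℝ) * (π / ω) := by rw [hω]; push_cast; field_simp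
  have up := fun (k p1 : ℝ) (hk : 0 < k) (hk1 : k < 1) (h1 : 0 < p1) (h12 : p1 < π / 2) =>
    upper_exists hk hk1 ω0 q0 q1 h1 h12 (n + 1) hL hLω hqω
  apply csInf_eq_of_forall_ge_of_forall_gt_exists_lt
  · obtain ⟨r, hr, -⟩ := up (1/2) (π/4) (by norm_num) (by norm_num) (by linarith) (by linarith)
    exact ⟨r, hr⟩
  · rintro r ⟨a, ha, hab, hpos, ⟨u, v, h1, h2, hvL, x0, hx0, hux⟩, rfl⟩
    have ia : IntervalIntegrable a volume 0 L := by
      rwa [intervalIntegrable_iff_integrableOn_Ioo_of_le hL.le]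
    have H := mkSol hL s0 ia hab h1 h2
    have hv0 : v 0 = 0 := by rw [h2 0 ⟨le_rfl, hL.le⟩]; simp
    have hu0 : u 0 ≠ 0 := fun h => hux (reg_unique hL ia h1 h2 h x0 hx0)
    have habs : (∫ x in (0:ℝ)..L, |a x - s ^ 2|) = ∫ x in (0:ℝ)..L, (a x - s ^ 2) := by
      apply intervalIntegral.integral_congr_ae_restrict
      rw [uIoc_of_le hL.le]
      filter_upwards [H.b_ae le_rfl le_rfl] with x hx
      exact abs_of_nonneg (by linarith)
    rw [habs]
    apply H.lower hL hn (by rw [hs]; field_simp) hv0 hvL hu0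
    intro h0
    rw [intervalIntegral.integral_eq_zero_iff_of_nonneg_ae] at h0
    · rw [Ioc_eq_empty (by linarith : ¬ L < 0), union_empty] at h0
      rw [Filter.EventuallyEq, ae_restrict_iff' measurableSet_Ioc] at h0
      refine hpos.ne' ?_
      refine measure_mono_null ?_ (ae_iff.1 h0)
      rintro x ⟨hx, hx2⟩
      simp only [mem_setOf_eq] at hx2 ⊢
      intro hcon
      have := hcon ⟨hx.1, hx.2.le⟩
      simp only [Pi.zero_apply] at this
      linarith
    · rw [Ioc_eq_empty (by linarith : ¬ L < 0), union_empty]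
      filter_upwards [H.b_ae le_rfl le_rfl] with x hx
      simp only [Pi.zero_apply]; linarith
    · exact H.b_ii le_rfl hL.le le_rfl
  · intro w hw
    set y0 := (n:ℝ) * π / (2 * (n + 1)) with hy0
    have ey : y0 = q * (π / 2) := by rw [hy0, hq]; field_simp
    have es : s = q * ω := by rw [hs, hω, hq]; field_simp
    have y00 : 0 < y0 := by rw [hy0]; positivity
    have y0pi : y0 < π := by rw [ey]; nlinarith
    -- first choose the angle
    have c1 : ContinuousAt (fun p : ℝ => 2 * ((n:ℝ) + 1) * s * cot (q * p)) (π / 2) := by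
      have e : cot = fun x => cos x / sin x := by funext x; exact cot_eq_cos_div_sin x
      rw [e]
      apply ContinuousAt.mul continuousAt_const
      apply ContinuousAt.div (by fun_prop) (by fun_prop)
      rw [← ey]; exact (sin_pos_of_pos_of_lt_pi y00 y0pi).ne'
    have ev1 : ∀ᶠ p in nhdsWithin (π / 2) (Iio (π / 2)),
        2 * ((n:ℝ) + 1) * s * cot (q * p) < w := by
      apply (c1.tendsto.eventually_lt_const (by rw [← ey]; exact hw)).filter_mono nhdsWithin_le_nhds
    have ev2 : ∀ᶠ p in nhdsWithin (π / 2) (Iio (π / 2)), p ∈ Ioo 0 (π / 2) :=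
      Ioo_mem_nhdsLT (by linarith)
    obtain ⟨p1, hp1, hp2⟩ := (ev1.and ev2).exists
    have c2 : Continuous (fun k : ℝ => q * cot (q * p1) * (2 * ((n + 1 : ℕ) : ℝ) * ω * k) +
        L * (ω ^ 2 * (1 - k ^ 2) / cos p1 ^ 3)) := by fun_prop
    have ev3 : ∀ᶠ k in nhdsWithin (1:ℝ) (Iio 1),
        q * cot (q * p1) * (2 * ((n + 1 : ℕ) : ℝ) * ω * k) +
        L * (ω ^ 2 * (1 - k ^ 2) / cos p1 ^ 3) < w := by
      apply (c2.continuousAt.tendsto.eventually_lt_const _).filter_mono nhdsWithin_le_nhds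
      refine lt_of_eq_of_lt ?_ hp1
      rw [es]; push_cast; ring
    have ev4 : ∀ᶠ k in nhdsWithin (1:ℝ) (Iio 1), k ∈ Ioo (0:ℝ) 1 := Ioo_mem_nhdsLT (by norm_num)
    obtain ⟨k, hk, hk2⟩ := (ev3.and ev4).exists
    obtain ⟨r, hr, hr2⟩ := up k p1 hk2.1 hk2.2 hp2.1 hp2.2
    exact ⟨r, hr, hr2.trans_lt hk⟩
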